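/- Let A be an r × E complex matrix of full row rank r (the rows of A are linearly independent), let y : E → ℂ satisfy Re(y_e) > 0 for all e ∈ E, and let Y := diag(y_e : e ∈ E). Then the matrix A·Y·A* is nonsingular, i.e. det(A·Y·A*) ≠ 0, where A* is the conjugate transpose of A. -/

import Mathlib

/-!
Formalization of statements from "Rayleigh Matroids" by Choe and Wagner.
Minors are built from Mathlib's matroid restriction and duality:
deletion is `M \ D = M ↾ (M.E \ D)` and contraction is `M / C = (M✶ \ C)✶`.
-/

open scoped Matroid

namespace RayleighMatroids

variable {α : Type*}

/-- The real part of the form `u ↦ u · diag(y) · u*` is `∑ e, Re (y e) * |u e|²`. -/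
lemma re_vecMul_diagonal_dotProduct_star {E : Type*} [Fintype E] [DecidableEq E]
    (y u : E → ℂ) :
    (Matrix.vecMul u (Matrix.diagonal y) ⬝ᵥ star u).re =
      ∑ e, (y e).re * Complex.normSq (u e) := by
  simp only [dotProduct, Matrix.vecMul_diagonal, Complex.re_sum, Pi.star_apply, RCLike.star_def]
  refine Finset.sum_congr rfl fun e _ => ?_
  rw [mul_right_comm, Complex.mul_conj, Complex.re_ofReal_mul, mul_comm]

/-- key step in Proposition 5.1: if `A` is an `r × E` complex matrix of
full row rank `r` and `y : E → ℂ` has entrywise positive real part, then `A·Y·A*` is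
nonsingular, where `Y = diag(y)` and `A*` is the conjugate transpose of `A`. -/
theorem det_mul_diagonal_conjTranspose_ne_zero
    {E : Type*} [Fintype E] [DecidableEq E] {r : ℕ}
    (A : Matrix (Fin r) E ℂ) (hA : LinearIndependent ℂ (fun i : Fin r => A i))
    (y : E → ℂ) (hy : ∀ e : E, 0 < (y e).re) :
    (A * Matrix.diagonal y * A.conjTranspose).det ≠ 0 := by
  intro hdet
  obtain ⟨v, hv, hvA⟩ := Matrix.exists_vecMul_eq_zero_iff.mpr hdet
  set u := Matrix.vecMul v A with hu
  have hform : Matrix.vecMul u (Matrix.diagonal y) ⬝ᵥ star u = 0 := by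
    rw [← Matrix.vecMul_vecMul, ← Matrix.vecMul_vecMul, ← hu] at hvA
    nth_rewrite 2 [hu]
    rw [Matrix.star_vecMul, Matrix.dotProduct_mulVec, hvA, zero_dotProduct]
  have hsum : ∑ e, (y e).re * Complex.normSq (u e) = 0 := by
    rw [← re_vecMul_diagonal_dotProduct_star, hform, Complex.zero_re]
  have hu0 : u = 0 := by
    ext e
    have he := (Finset.sum_eq_zero_iff_of_nonneg fun e _ =>
      mul_nonneg (hy e).le (Complex.normSq_nonneg (u e))).mp hsum e (Finset.mem_univ e)
    exact Complex.normSq_eq_zero.mp ((mul_eq_zero.mp he).resolve_left (hy e).ne')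
  exact hv (Matrix.vecMul_injective_iff.mpr hA (hu0.trans (Matrix.zero_vecMul A).symm))

end RayleighMatroids
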